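/- Let R be a commutative Noetherian ring such that (i) every finitely generated R-module M admits a finite resolution 0 → P_d → ⋯ → P_1 → P_0 → M → 0 by finitely generated projective R-modules, and (ii) every finitely generated projective R-module is free. Let K be a cochain complex of R-modules such that H^n(K) is a finitely generated R-module for every n and H^n(K) = 0 for all but finitely many n. Then there exist a cochain complex F of R-modules with each F^n a finitely generated free R-module and F^n = 0 for all but finitely many n, together with a quasi-isomorphism F ⟶ K. -/

import Mathlib

open CategoryTheory HomologicalComplex

namespace PerfAux
universe u
open CategoryTheory Limits Pretriangulated DerivedCategory

section
variable {R : Type} [CommRing R]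

/-- Bounded complexes of finitely generated free modules. -/
def Perf (F : CochainComplex (ModuleCat.{u} R) ℤ) : Prop :=
  (∀ n : ℤ, Module.Finite R (F.X n) ∧ Module.Free R (F.X n)) ∧
    ∃ a b : ℤ, F.IsStrictlyGE a ∧ F.IsStrictlyLE b

lemma finite_of_iso {M N : ModuleCat.{u} R} (e : M ≅ N) (h : Module.Finite R M) :
    Module.Finite R N := Module.Finite.equiv e.toLinearEquiv

lemma free_of_iso {M N : ModuleCat.{u} R} (e : M ≅ N) (h : Module.Free R M) :
    Module.Free R N := Module.Free.of_equiv e.toLinearEquiv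

lemma finite_of_isZero {M : ModuleCat.{u} R} (h : IsZero M) : Module.Finite R M := by
  have := ModuleCat.subsingleton_of_isZero h
  infer_instance

lemma free_of_isZero {M : ModuleCat.{u} R} (h : IsZero M) : Module.Free R M := by
  have := ModuleCat.subsingleton_of_isZero h
  infer_instance

lemma Perf.kproj {F : CochainComplex (ModuleCat.{u} R) ℤ} (hF : Perf F) : F.IsKProjective := by
  obtain ⟨h, a, b, _, _⟩ := hF
  have : ∀ n, Projective (F.X n) := fun n => by
    have := (h n).2
    exact (IsProjective.iff_projective (F.X n)).1 inferInstance
  exact CochainComplex.isKProjective_of_projective F b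

lemma Perf.shift {F : CochainComplex (ModuleCat.{u} R) ℤ} (hF : Perf F) (k : ℤ) :
    Perf (F⟦k⟧) := by
  obtain ⟨h, a, b, _, _⟩ := hF
  exact ⟨fun n => h (n + k), a - k, b - k, F.isStrictlyGE_shift a k _ (by lia),
    F.isStrictlyLE_shift b k _ (by lia)⟩

lemma Perf.cone {F G : CochainComplex (ModuleCat.{u} R) ℤ} (hF : Perf F) (hG : Perf G)
    (f : F ⟶ G) : Perf (CochainComplex.mappingCone f) := by
  obtain ⟨hF, a, b, _, _⟩ := hF
  obtain ⟨hG, a', b', _, _⟩ := hG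
  have e : ∀ n, (CochainComplex.mappingCone f).X n ≅ F.X (n + 1) ⊞ G.X n :=
    fun n => HomologicalComplex.homotopyCofiber.XIsoBiprod f n (n + 1) rfl
  refine ⟨fun n => ?_, min (a - 1) a', max (b - 1) b', ?_, ?_⟩
  · have e' := e n ≪≫ ModuleCat.biprodIsoProd (F.X (n+1)) (G.X n)
    have h1 := (hF (n+1)).1
    have h2 := (hF (n+1)).2
    have h3 := (hG n).1
    have h4 := (hG n).2
    exact ⟨finite_of_iso e'.symm (inferInstanceAs (Module.Finite R (F.X (n+1) × G.X n))),
      free_of_iso e'.symm (inferInstanceAs (Module.Free R (F.X (n+1) × G.X n)))⟩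
  · rw [CochainComplex.isStrictlyGE_iff]
    intro i hi
    refine IsZero.of_iso ?_ (e i)
    rw [biprod_isZero_iff]
    exact ⟨F.isZero_of_isStrictlyGE a _ (by grind), G.isZero_of_isStrictlyGE a' _ (by grind)⟩
  · rw [CochainComplex.isStrictlyLE_iff]
    intro i hi
    refine IsZero.of_iso ?_ (e i)
    rw [biprod_isZero_iff]
    exact ⟨F.isZero_of_isStrictlyLE b _ (by grind), G.isZero_of_isStrictlyLE b' _ (by grind)⟩

variable [HasDerivedCategory.{u+1} (ModuleCat.{u} R)]

lemma exists_lift {F L : CochainComplex (ModuleCat.{u} R) ℤ} [F.IsKProjective]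
    (g : Q.obj F ⟶ Q.obj L) : ∃ f : F ⟶ L, Q.map f = g := by
  obtain ⟨f', hf'⟩ := (CochainComplex.IsKProjective.Qh_map_bijective F
    ((HomotopyCategory.quotient _ _).obj L)).surjective
      ((quotientCompQhIso _).hom.app F ≫ g ≫ (quotientCompQhIso _).inv.app L)
  obtain ⟨f, rfl⟩ := (HomotopyCategory.quotient _ _).map_surjective f'
  refine ⟨f, ?_⟩
  have := quotientCompQhIso_hom_naturality f
  rw [hf'] at this
  simpa using this.symm

/-- Objects isomorphic to perfect ones -/
def P (X : DerivedCategory (ModuleCat.{u} R)) : Prop :=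
  ∃ F, Perf F ∧ Nonempty (Q.obj F ≅ X)

lemma P.of_iso {X Y : DerivedCategory (ModuleCat.{u} R)} (hX : P X) (e : X ≅ Y) : P Y := by
  obtain ⟨F, hF, ⟨i⟩⟩ := hX
  exact ⟨F, hF, ⟨i ≪≫ e⟩⟩

lemma P.shift {X : DerivedCategory (ModuleCat.{u} R)} (hX : P X) (k : ℤ) : P (X⟦k⟧) := by
  obtain ⟨F, hF, ⟨i⟩⟩ := hX
  exact ⟨F⟦k⟧, hF.shift k, ⟨(Q.commShiftIso k).app F ≪≫ (shiftFunctor _ k).mapIso i⟩⟩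

lemma P.ext3 (T : Triangle (DerivedCategory (ModuleCat.{u} R))) (hT : T ∈ distTriang _)
    (h1 : P T.obj₁) (h2 : P T.obj₂) : P T.obj₃ := by
  obtain ⟨F, hF, ⟨i⟩⟩ := h1
  obtain ⟨G, hG, ⟨j⟩⟩ := h2
  have := hF.kproj
  obtain ⟨f, hf⟩ := exists_lift (i.hom ≫ T.mor₁ ≫ j.inv)
  refine ⟨_, hF.cone hG f, ⟨?_⟩⟩
  exact Triangle.π₃.mapIso (isoTriangleOfIso₁₂ _ _ (mappingCone_triangle_distinguished f) hT i j
    (by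
      change Q.map f ≫ j.hom = i.hom ≫ T.mor₁
      simp [hf]))

lemma P.ext2 (T : Triangle (DerivedCategory (ModuleCat.{u} R))) (hT : T ∈ distTriang _)
    (h1 : P T.obj₁) (h3 : P T.obj₃) : P T.obj₂ :=
  P.ext3 _ (inv_rot_of_distTriang _ hT) (h3.shift (-1)) h1

lemma P_single (H : ∀ M : ModuleCat.{u} R, Module.Finite R M →
      P ((singleFunctor (ModuleCat.{u} R) 0).obj M)) (M : ModuleCat.{u} R) (hM : Module.Finite R M)
    (n : ℤ) : P ((singleFunctor (ModuleCat.{u} R) n).obj M) :=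
  ((H M hM).shift (-n)).of_iso
    (((singleFunctors (ModuleCat.{u} R)).shiftIso (-n) n 0 (by simp)).app M)

/-- homology of truncLE -/
noncomputable def isoLE (K : CochainComplex (ModuleCat.{u} R) ℤ) (n i : ℤ) (h : i ≤ n) :
    (K.truncLE n).homology i ≅ K.homology i :=
  haveI := K.quasiIsoAt_ιTruncLE n i h
  isoOfQuasiIsoAt (K.ιTruncLE n) i

/-- homology of truncGE -/
noncomputable def isoGE (K : CochainComplex (ModuleCat.{u} R) ℤ) (n i : ℤ) (h : n ≤ i) :
    K.homology i ≅ (K.truncGE n).homology i :=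
  haveI := K.quasiIsoAt_πTruncGE n i h
  isoOfQuasiIsoAt (K.πTruncGE n) i

lemma dev (H : ∀ M : ModuleCat.{u} R, Module.Finite R M →
      P ((singleFunctor (ModuleCat.{u} R) 0).obj M)) (m : ℕ) :
    ∀ (a : ℤ) (K : CochainComplex (ModuleCat.{u} R) ℤ), K.IsGE a → K.IsLE (a + m) →
      (∀ n : ℤ, Module.Finite R (K.homology n)) → P (Q.obj K) := by
  induction m with
  | zero =>
    intro a K _ h2 hK
    simp only [Nat.cast_zero, add_zero] at h2
    obtain ⟨Y, ⟨e⟩⟩ := exists_iso_singleFunctor_obj_of_isGE_of_isLE (Q.obj K) a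
    refine (P_single H Y ?_ a).of_iso e.symm
    let e' : K.homology a ≅ Y := ((homologyFunctorFactors _ a).app K).symm ≪≫
      (homologyFunctor _ a).mapIso (e ≪≫ (singleFunctorIsoCompQ _ a).app Y) ≪≫
      (homologyFunctorFactors _ a).app _ ≪≫
      HomologicalComplex.singleObjHomologySelfIso (.up ℤ) a Y
    exact finite_of_iso e' (hK a)
  | succ m ih =>
    intro a K h1 h2 hK
    have h := K.shortComplexTruncLE_shortExact a
    refine P.ext2 _ (triangleOfSES_distinguished h) (ih a (K.truncLE a) ?_ ?_ ?_)
      ((ih (a + 1) (K.truncGE (a + 1)) ?_ ?_ ?_).of_iso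
        (asIso (Q.map (K.shortComplexTruncLEX₃ToTruncGE a (a + 1) (by lia)))).symm)
    · rw [CochainComplex.isGE_iff]
      intro i hi
      rw [exactAt_iff_isZero_homology]
      exact (K.isZero_of_isGE a i hi).of_iso (isoLE K a i (by lia))
    · exact CochainComplex.isLE_of_le _ a _ (by lia)
    · intro n
      by_cases hn : n ≤ a
      · exact finite_of_iso (isoLE K a n hn).symm (hK n)
      · exact finite_of_isZero ((K.truncLE a).isZero_of_isLE a n (by lia))
    · infer_instance
    · rw [CochainComplex.isLE_iff]
      intro i hi
      rw [exactAt_iff_isZero_homology]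
      push_cast at h2
      exact (K.isZero_of_isLE (a + (m + 1)) i (by lia)).of_iso (isoGE K (a+1) i (by lia)).symm
    · intro n
      by_cases hn : a + 1 ≤ n
      · exact finite_of_iso (isoGE K (a+1) n hn) (hK n)
      · exact finite_of_isZero ((K.truncGE (a+1)).isZero_of_isGE (a+1) n (by lia))

lemma final (H : ∀ M : ModuleCat.{u} R, Module.Finite R M →
      P ((singleFunctor (ModuleCat.{u} R) 0).obj M)) (K : CochainComplex (ModuleCat.{u} R) ℤ)
    (hfg : ∀ n : ℤ, Module.Finite R (K.homology n))
    (hbdd : {n : ℤ | ¬ Limits.IsZero (K.homology n)}.Finite) :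
    ∃ (F : CochainComplex (ModuleCat R) ℤ) (φ : F ⟶ K),
      (∀ n : ℤ, Module.Finite R (F.X n) ∧ Module.Free R (F.X n)) ∧
      {n : ℤ | ¬ Limits.IsZero (F.X n)}.Finite ∧ QuasiIso φ := by
  obtain ⟨a, ha⟩ := hbdd.bddBelow
  obtain ⟨b, hb⟩ := hbdd.bddAbove
  have : P (Q.obj K) := by
    refine dev H (b - a).toNat a K ?_ ?_ hfg
    · rw [CochainComplex.isGE_iff]
      intro i hi
      rw [exactAt_iff_isZero_homology]
      by_contra h
      have := ha h
      lia
    · rw [CochainComplex.isLE_iff]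
      intro i hi
      rw [exactAt_iff_isZero_homology]
      by_contra h
      have := hb h
      lia
  obtain ⟨F, hF, ⟨e⟩⟩ := this
  have := hF.kproj
  obtain ⟨f, hf⟩ := exists_lift e.hom
  refine ⟨F, f, hF.1, ?_, ?_⟩
  · obtain ⟨-, a, b, _, _⟩ := hF
    refine (Set.finite_Icc a b).subset fun n hn => ?_
    by_contra h
    apply hn
    rw [Set.mem_Icc, not_and_or] at h
    rcases h with h | h
    · exact F.isZero_of_isStrictlyGE a _ (by lia)
    · exact F.isZero_of_isStrictlyLE b _ (by lia)
  · rw [← isIso_Q_map_iff_quasiIso, hf]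
    infer_instance


lemma single_zero
    (hres : ∀ (M : Type) [AddCommGroup M] [Module R M], Module.Finite R M →
      ∃ (d : ℕ) (P : ChainComplex (ModuleCat R) ℕ)
        (π : P ⟶ (ChainComplex.single₀ (ModuleCat R)).obj (ModuleCat.of R M)),
        (∀ n : ℕ, Module.Finite R (P.X n) ∧ Module.Projective R (P.X n)) ∧
        (∀ n : ℕ, d < n → Limits.IsZero (P.X n)) ∧ QuasiIso π)
    (hfree : ∀ (N : Type) [AddCommGroup N] [Module R N],
      Module.Finite R N → Module.Projective R N → Module.Free R N)
    (M : ModuleCat.{u} R) (hM : Module.Finite R M) :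
    P ((singleFunctor (ModuleCat.{u} R) 0).obj M) := by
  have : Small.{0} M := Module.Finite.small R M
  obtain ⟨d, A, π, hA, hd, hπ⟩ := hres (Shrink.{0} M)
    (Module.Finite.equiv (Shrink.linearEquiv R M).symm)
  let U := ModuleCat.uliftFunctor.{u, 0} R
  let B : ChainComplex (ModuleCat.{u} R) ℕ := (U.mapHomologicalComplex _).obj A
  let e : U.obj (ModuleCat.of R (Shrink.{0} M)) ≅ M :=
    (ULift.moduleEquiv.trans (Shrink.linearEquiv R M)).toModuleIso
  let ρ : B ⟶ (ChainComplex.single₀ (ModuleCat.{u} R)).obj M :=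
    (U.mapHomologicalComplex _).map π ≫
      (HomologicalComplex.singleMapHomologicalComplex U (.down ℕ) 0).hom.app _ ≫
      (ChainComplex.single₀ (ModuleCat.{u} R)).map e.hom
  have hρ : QuasiIso ρ := by
    dsimp only [ρ]
    infer_instance
  have hB : ∀ n, Module.Finite R (B.X n) ∧ Module.Free R (B.X n) := fun n => by
    have h1 := (hA n).1
    have h2 := hfree _ (hA n).1 (hA n).2
    exact ⟨inferInstanceAs (Module.Finite R (ULift.{u} (A.X n))),
      inferInstanceAs (Module.Free R (ULift.{u} (A.X n)))⟩
  let res : ProjectiveResolution M :=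
    { complex := B
      projective := fun n => by
        have h : Module.Free R (B.X n) := (hB n).2
        have h' : Module.Projective R (B.X n) := @Module.Projective.of_free _ _ _ _ _ h
        exact (IsProjective.iff_projective (B.X n)).1 h'
      π := ρ }
  refine ⟨res.cochainComplex, ⟨fun n => ?_, -d, 0, ?_, inferInstance⟩,
    ⟨asIso (Q.map res.π') ≪≫ ((singleFunctorIsoCompQ _ 0).app M).symm⟩⟩
  · by_cases hn : n ≤ 0
    · obtain ⟨k, rfl⟩ := Int.exists_eq_neg_ofNat hn
      have i := (res.cochainComplexXIso (-k) k).symm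
      exact ⟨finite_of_iso i (hB k).1, free_of_iso i (hB k).2⟩
    · have := CochainComplex.isZero_of_isStrictlyLE res.cochainComplex 0 n (by lia)
      exact ⟨finite_of_isZero this, free_of_isZero this⟩
  · rw [CochainComplex.isStrictlyGE_iff]
    intro n hn
    obtain ⟨k, rfl⟩ := Int.exists_eq_neg_ofNat (show n ≤ 0 by lia)
    exact (U.map_isZero (hd k (by lia))).of_iso (res.cochainComplexXIso (-k) k)

end

end PerfAux




/-- Over a commutative Noetherian ring `R` in which (i) every finitely generated module
admits a finite resolution by finitely generated projective modules and (ii) every finitely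
generated projective module is free, any cochain complex with finitely generated cohomology
concentrated in finitely many degrees is quasi-isomorphic to a bounded complex of finitely
generated free modules. -/
theorem perfect_of_fg_cohomology (R : Type) [CommRing R] [IsNoetherianRing R]
    (hres : ∀ (M : Type) [AddCommGroup M] [Module R M], Module.Finite R M →
      ∃ (d : ℕ) (P : ChainComplex (ModuleCat R) ℕ)
        (π : P ⟶ (ChainComplex.single₀ (ModuleCat R)).obj (ModuleCat.of R M)),
        (∀ n : ℕ, Module.Finite R (P.X n) ∧ Module.Projective R (P.X n)) ∧
        (∀ n : ℕ, d < n → Limits.IsZero (P.X n)) ∧ QuasiIso π)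
    (hfree : ∀ (N : Type) [AddCommGroup N] [Module R N],
      Module.Finite R N → Module.Projective R N → Module.Free R N)
    (K : CochainComplex (ModuleCat R) ℤ)
    (hfg : ∀ n : ℤ, Module.Finite R (K.homology n))
    (hbdd : {n : ℤ | ¬ Limits.IsZero (K.homology n)}.Finite) :
    ∃ (F : CochainComplex (ModuleCat R) ℤ) (φ : F ⟶ K),
      (∀ n : ℤ, Module.Finite R (F.X n) ∧ Module.Free R (F.X n)) ∧
      {n : ℤ | ¬ Limits.IsZero (F.X n)}.Finite ∧ QuasiIso φ := by
  let := HasDerivedCategory.standard (ModuleCat R)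
  exact PerfAux.final (PerfAux.single_zero hres hfree) K hfg hbdd
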